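/- With a fair coin (p = 1/2), the expected duration of the game between S₁ = TTTHTTT and S₂ = TTHTTTTHT is exactly 9110/71. -/

import Mathlib

open MeasureTheory ENNReal

def occursAt (S : List Bool) (ω : ℕ → Bool) (n : ℕ) : Prop :=
  S.length ≤ n ∧ ∀ j < S.length, ω (n - S.length + j) = S.getD j false

/-- The duration of the game between `S₁` and `S₂`: the least `n` such that
`S₁` or `S₂` occurs ending at trial `n` (`⊤` if neither ever occurs). -/
noncomputable def duration (S₁ S₂ : List Bool) (ω : ℕ → Bool) : ℕ∞ :=
  ⨅ (n : ℕ) (_ : occursAt S₁ ω n ∨ occursAt S₂ ω n), (n : ℕ∞)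

/-- The first `n` symbols of `ω`, the most recent one first. -/
def history (ω : ℕ → Bool) : ℕ → List Bool
  | 0 => []
  | n + 1 => ω n :: history ω n

lemma reverse_prefix_history (ω : ℕ → Bool) (l : List Bool) (n : ℕ) :
    l <+: history ω n ↔
      l.length ≤ n ∧ ∀ j < l.length, ω (n - l.length + j) = l.reverse.getD j false := by
  induction l generalizing n with
  | nil => simp
  | cons b l ih =>
    cases n with
    | zero => simp [history]
    | succ m =>
      rw [history, List.cons_prefix_cons, ih]
      simp only [List.length_cons, List.reverse_cons, add_le_add_iff_right, Nat.add_sub_add_right]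
      constructor
      · rintro ⟨hb, hl, h⟩
        refine ⟨hl, fun j hj => ?_⟩
        rcases Nat.lt_succ_iff_lt_or_eq.1 hj with hj | rfl
        · rw [h j hj, List.getD_append _ _ _ _ (by simpa using hj)]
        · rw [Nat.sub_add_cancel hl, List.getD_append_right _ _ _ _ (by simp)]
          simp [hb]
      · rintro ⟨hl, h⟩
        refine ⟨?_, hl, fun j hj => ?_⟩
        · have := h l.length (by simp)
          rw [Nat.sub_add_cancel hl, List.getD_append_right _ _ _ _ (by simp)] at this
          simpa using this.symm
        · rw [h j (by omega), List.getD_append _ _ _ _ (by simpa using hj)]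

lemma occursAt_iff (S : List Bool) (ω : ℕ → Bool) (n : ℕ) :
    occursAt S ω n ↔ S.reverse <+: history ω n := by
  rw [reverse_prefix_history]
  simp [occursAt]

lemma duration_eq_tsum (S₁ S₂ : List Bool) (ω : ℕ → Bool) (A : ℕ → Prop)
    (hA : ∀ n, A n ↔ ∀ m ≤ n, ¬(occursAt S₁ ω m ∨ occursAt S₂ ω m)) :
    (duration S₁ S₂ ω : ℝ≥0∞) = ∑' n, {n | A n}.indicator (fun _ => (1 : ℝ≥0∞)) n := by
  classical
  by_cases h : ∃ n, occursAt S₁ ω n ∨ occursAt S₂ ω n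
  · have hD : duration S₁ S₂ ω = (Nat.find h : ℕ∞) := by
      refine le_antisymm (iInf₂_le (Nat.find h) (Nat.find_spec h)) (le_iInf₂ fun n hn => ?_)
      exact_mod_cast Nat.find_min' h hn
    have hA' : ∀ n, A n ↔ n < Nat.find h := fun n => by rw [hA, Nat.lt_find_iff]
    rw [hD, tsum_eq_sum (s := Finset.range (Nat.find h))]
    · rw [Finset.sum_congr rfl (g := fun _ => 1)]
      · simp
      · intro n hn
        exact Set.indicator_of_mem ((hA' n).2 (Finset.mem_range.1 hn)) _
    · intro n hn
      simpa [hA'] using hn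
  · push Not at h
    have hD : duration S₁ S₂ ω = ⊤ := by
      simp [duration, h]
    have hA' : ∀ n, A n := fun n => (hA n).2 fun m _ => by simpa using h m
    simp [hD, hA']

/-- The state after `n` trials of the automaton with transition function `δ` started at `s`. -/
def run {σ : Type*} (δ : σ → Bool → σ) (s : σ) (ω : ℕ → Bool) : ℕ → σ
  | 0 => s
  | n + 1 => δ (run δ s ω n) (ω n)

lemma run_congr {σ : Type*} (δ : σ → Bool → σ) (s : σ) {ω ω' : ℕ → Bool} {n : ℕ}
    (h : ∀ i < n, ω i = ω' i) : run δ s ω n = run δ s ω' n := by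
  induction n with
  | zero => rfl
  | succ n ih => rw [run, run, ih fun i hi => h i (by omega), h n (by omega)]

lemma measurable_run {σ : Type*} [MeasurableSpace σ] [DiscreteMeasurableSpace σ] [Countable σ]
    (δ : σ → Bool → σ) (s : σ) (n : ℕ) : Measurable fun ω => run δ s ω n := by
  induction n with
  | zero => exact measurable_const
  | succ n ih =>
    exact (Measurable.of_discrete (f := fun x : σ × Bool => δ x.1 x.2)).comp
      (ih.prodMk (measurable_pi_apply n))

section FairCoin

variable {μ : Measure (ℕ → Bool)}

lemma measure_eq_sum_cylinder (n : ℕ) (B : Set (ℕ → Bool)) :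
    μ B = ∑ w : Fin n → Bool, μ (B ∩ {ω | ∀ i : Fin n, ω i = w i}) := by
  have hm : Measurable fun (ω : ℕ → Bool) (i : Fin n) => ω i :=
    measurable_pi_lambda _ fun i => measurable_pi_apply _
  have hcyl : ∀ w : Fin n → Bool, {ω : ℕ → Bool | ∀ i : Fin n, ω i = w i} =
      (fun (ω : ℕ → Bool) (i : Fin n) => ω i) ⁻¹' {w} := fun w => by
    ext ω
    simp [funext_iff]
  have hfiber : ∀ w, MeasurableSet ((fun (ω : ℕ → Bool) (i : Fin n) => ω i) ⁻¹' {w}) := fun w =>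
    hm (measurableSet_singleton w)
  have := sum_measure_preimage_singleton (μ := μ.restrict B) (Finset.univ : Finset (Fin n → Bool))
    fun w _ => hfiber w
  simp only [Finset.coe_univ, Set.preimage_univ, Measure.restrict_apply_univ] at this
  rw [← this]
  refine Finset.sum_congr rfl fun w _ => ?_
  rw [Measure.restrict_apply (hfiber w), hcyl, Set.inter_comm]

lemma measure_inter_coordinate
    (hμ : ∀ (n : ℕ) (b : ℕ → Bool), μ {ω | ∀ i < n, ω i = b i} = (1 / 2 : ℝ≥0∞) ^ n)
    (n : ℕ) (b : Bool) (A : Set (ℕ → Bool))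
    (hA : ∀ ω ω', (∀ i < n, ω i = ω' i) → (ω ∈ A ↔ ω' ∈ A)) :
    μ (A ∩ {ω | ω n = b}) = 1 / 2 * μ A := by
  rw [measure_eq_sum_cylinder n, measure_eq_sum_cylinder n A, Finset.mul_sum]
  refine Finset.sum_congr rfl fun w _ => ?_
  let v : ℕ → Bool := fun i => if h : i < n then w ⟨i, h⟩ else b
  have hcyl : {ω : ℕ → Bool | ∀ i : Fin n, ω i = w i} = {ω | ∀ i < n, ω i = v i} := by
    ext ω
    exact ⟨fun h i hi => by simpa [v, hi] using h ⟨i, hi⟩,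
      fun h i => by simpa [v] using h i i.2⟩
  rw [hcyl]
  by_cases hv : v ∈ A
  · have h₁ : A ∩ {ω | ∀ i < n, ω i = v i} = {ω | ∀ i < n, ω i = v i} :=
      Set.inter_eq_right.2 fun ω hω => (hA ω v hω).2 hv
    have h₂ : A ∩ {ω | ω n = b} ∩ {ω | ∀ i < n, ω i = v i} =
        {ω | ∀ i < n + 1, ω i = v i} := by
      rw [Set.inter_right_comm, h₁]
      ext ω
      simp only [Set.mem_inter_iff, Set.mem_ofPred_eq, Nat.forall_lt_succ_right]
      simp [v]
    rw [h₁, h₂, hμ, hμ, pow_succ']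
  · have h₁ : A ∩ {ω | ∀ i < n, ω i = v i} = ∅ :=
      Set.eq_empty_of_forall_notMem fun ω hω => hv ((hA ω v hω.2).1 hω.1)
    rw [Set.inter_right_comm, h₁]
    simp

variable {σ : Type*} [Fintype σ] [MeasurableSpace σ] [DiscreteMeasurableSpace σ]

lemma integral_run [IsProbabilityMeasure μ] (δ : σ → Bool → σ) (s : σ) (n : ℕ) (g : σ → ℝ) :
    ∫ ω, g (run δ s ω n) ∂μ = ∑ t, μ.real {ω | run δ s ω n = t} * g t := by
  have hm := measurable_run δ s n
  rw [← integral_map (f := g) hm.aemeasurable (by fun_prop), integral_fintype .of_finite]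
  refine Finset.sum_congr rfl fun t _ => ?_
  rw [map_measureReal_apply hm (measurableSet_singleton t)]
  rfl

lemma integral_run_succ [IsProbabilityMeasure μ]
    (hμ : ∀ (n : ℕ) (b : ℕ → Bool), μ {ω | ∀ i < n, ω i = b i} = (1 / 2 : ℝ≥0∞) ^ n)
    (δ : σ → Bool → σ) (s : σ) (n : ℕ) (g : σ → ℝ) :
    ∫ ω, g (run δ s ω (n + 1)) ∂μ =
      ∫ ω, 1 / 2 * (g (δ (run δ s ω n) false) + g (δ (run δ s ω n) true)) ∂μ := by
  rw [integral_run δ s n fun t => 1 / 2 * (g (δ t false) + g (δ t true))]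
  have hm := (measurable_run δ s n).prodMk (measurable_pi_apply (X := fun _ => Bool) n)
  have := integral_map (μ := μ) (f := fun x : σ × Bool => g (δ x.1 x.2)) hm.aemeasurable
    (by fun_prop)
  simp only [run]
  rw [← this, integral_fintype .of_finite, Fintype.sum_prod_type]
  refine Finset.sum_congr rfl fun t _ => ?_
  have key : ∀ b, (μ.map fun ω => (run δ s ω n, ω n)).real {(t, b)} =
      1 / 2 * μ.real {ω | run δ s ω n = t} := fun b => by
    rw [map_measureReal_apply hm (measurableSet_singleton _)]
    have := measure_inter_coordinate hμ n b {ω | run δ s ω n = t} fun ω ω' h => by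
      simp [run_congr δ s h]
    have hset : (fun ω => (run δ s ω n, ω n)) ⁻¹' {(t, b)} =
        {ω | run δ s ω n = t} ∩ {ω | ω n = b} := by
      ext ω
      simp
    rw [hset, measureReal_def, this]
    simp [measureReal_def]
  simp only [Fintype.sum_bool, key, smul_eq_mul]
  ring

/-- The expected hitting time of `a` is given by any solution `h` of the first-step equations. -/
lemma tsum_measure_run_ne [IsProbabilityMeasure μ]
    (hμ : ∀ (n : ℕ) (b : ℕ → Bool), μ {ω | ∀ i < n, ω i = b i} = (1 / 2 : ℝ≥0∞) ^ n)
    (δ : σ → Bool → σ) (s a : σ) (h : σ → ℝ) (h_nonneg : ∀ t, 0 ≤ h t) (ha : h a = 0)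
    (hδ : ∀ b, δ a b = a) (hstep : ∀ t ≠ a, h t = 1 + 1 / 2 * (h (δ t false) + h (δ t true))) :
    ∑' n, μ {ω | run δ s ω n ≠ a} = ENNReal.ofReal (h s) := by
  classical
  have hint : ∀ (g : σ → ℝ) n, Integrable (fun ω => g (run δ s ω n)) μ := fun g n =>
    (Integrable.of_finite (μ := μ.map fun ω => run δ s ω n) (f := g)).comp_measurable
      (measurable_run δ s n)
  have hmeas : ∀ n, MeasurableSet {ω | run δ s ω n ≠ a} := fun n =>
    measurable_run δ s n (.of_discrete (s := {t | t ≠ a}))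
  have hind : ∀ n, ∫ ω, (if run δ s ω n = a then (0 : ℝ) else 1) ∂μ =
      μ.real {ω | run δ s ω n ≠ a} := fun n => by
    rw [← integral_indicator_one (hmeas n)]
    congr 1 with ω
    simp [Set.indicator_apply]
  have hdrop : ∀ n, ∫ ω, h (run δ s ω (n + 1)) ∂μ =
      ∫ ω, h (run δ s ω n) ∂μ - μ.real {ω | run δ s ω n ≠ a} := fun n => by
    rw [integral_run_succ hμ, ← hind, ← integral_sub (hint h n)
      (hint (fun t => if t = a then 0 else 1) n)]
    congr 1 with ω
    by_cases ht : run δ s ω n = a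
    · simp [ht, hδ, ha]
    · rw [if_neg ht, hstep _ ht]
      ring
  have hsum : ∀ N, ∑ n ∈ Finset.range N, μ.real {ω | run δ s ω n ≠ a} =
      h s - ∫ ω, h (run δ s ω N) ∂μ := fun N => by
    induction N with
    | zero => simp [run]
    | succ N ih =>
      rw [Finset.sum_range_succ, ih, hdrop]
      ring
  have hsummable : Summable fun n => μ.real {ω | run δ s ω n ≠ a} :=
    summable_of_sum_range_le (c := h s) (fun n => measureReal_nonneg) fun N => by
      rw [hsum]
      have : 0 ≤ ∫ ω, h (run δ s ω N) ∂μ := integral_nonneg fun ω => h_nonneg _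
      linarith
  have hlim : Filter.Tendsto (fun N => ∫ ω, h (run δ s ω N) ∂μ) Filter.atTop (nhds 0) := by
    have hle : ∀ t, h t ≤ (∑ u, h u) * if t = a then 0 else 1 := fun t => by
      by_cases ht : t = a
      · simp [ht, ha]
      · simpa [ht] using Finset.single_le_sum (fun u _ => h_nonneg u) (Finset.mem_univ t)
    refine squeeze_zero (fun N => integral_nonneg fun ω => h_nonneg _) (fun N => ?_)
      (by simpa using hsummable.tendsto_atTop_zero.const_mul (∑ u, h u))
    rw [← hind, ← integral_const_mul]
    exact integral_mono (hint h N) (hint (fun t => (∑ u, h u) * if t = a then 0 else 1) N)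
      fun ω => hle _
  have hhas : HasSum (fun n => μ.real {ω | run δ s ω n ≠ a}) (h s) := by
    rw [hasSum_iff_tendsto_nat_of_nonneg fun n => measureReal_nonneg]
    simp_rw [hsum]
    simpa using hlim.const_sub (h s)
  rw [← hhas.tsum_eq, ENNReal.ofReal_tsum_of_nonneg (fun n => measureReal_nonneg) hsummable]
  simp [measureReal_def]

end FairCoin

/-- `p ∈ gamePrefixes` iff `p.reverse` is a prefix of one of the two patterns. -/
def gamePrefixes : List (List Bool) :=
  [false, false, false, true, false, false, false].tails ++
    [false, true, false, false, false, false, true, false, false].tails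

/-- The proper prefixes of the two patterns, reversed; state `13` means the game is over. -/
def gameLabel : Fin 14 → List Bool :=
  ![[], [false], [false, false], [true, false, false], [false, false, false],
    [false, true, false, false], [true, false, false, false], [false, false, true, false, false],
    [false, true, false, false, false], [false, false, false, true, false, false],
    [false, false, true, false, false, false], [false, false, false, false, true, false, false],
    [true, false, false, false, false, true, false, false], []]

/-- The transitions of the automaton that tracks the longest suffix of the history that is
a prefix of one of the patterns. -/
def gameStep (s : Fin 14) (b : Bool) : Fin 14 :=
  if b then ![0, 0, 3, 0, 6, 0, 0, 3, 0, 6, 3, 12, 0, 13] s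
  else ![1, 2, 4, 5, 4, 7, 8, 9, 10, 11, 13, 4, 13, 13] s

lemma prefix_cons_congr {l l' : List Bool}
    (h : ∀ p ∈ gamePrefixes, p <+: l ↔ p <+: l') (b : Bool) :
    ∀ p ∈ gamePrefixes, p <+: b :: l ↔ p <+: b :: l' := by
  have htail : ∀ p ∈ gamePrefixes, p.tail ∈ gamePrefixes := by decide
  intro p hp
  cases p with
  | nil => simp
  | cons c p => rw [List.cons_prefix_cons, List.cons_prefix_cons, h p (htail _ hp)]

lemma gameStep_eq_iff : ∀ s ≠ 13, ∀ b, gameStep s b = 13 ↔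
    [false, false, false, true, false, false, false] <+: b :: gameLabel s ∨
    [false, true, false, false, false, false, true, false, false] <+: b :: gameLabel s := by
  decide

lemma gameLabel_gameStep : ∀ s ≠ 13, ∀ b, gameStep s b ≠ 13 → ∀ p ∈ gamePrefixes,
    p <+: b :: gameLabel s ↔ p <+: gameLabel (gameStep s b) := by
  decide

lemma run_gameStep (ω : ℕ → Bool) (n : ℕ) :
    (run gameStep 0 ω n ≠ 13 →
      ∀ p ∈ gamePrefixes, p <+: history ω n ↔ p <+: gameLabel (run gameStep 0 ω n)) ∧
    (run gameStep 0 ω n ≠ 13 ↔ ∀ m ≤ n,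
      ¬(occursAt [false, false, false, true, false, false, false] ω m ∨
        occursAt [false, false, true, false, false, false, false, true, false] ω m)) := by
  simp only [occursAt_iff, List.reverse_cons, List.reverse_nil, List.nil_append, List.cons_append]
  induction n with
  | zero => simp [run, history, gameLabel]
  | succ n ih =>
    obtain ⟨ih₁, ih₂⟩ := ih
    simp only [Nat.le_succ_iff, or_imp, forall_and, forall_eq]
    rw [← ih₂, run]
    by_cases hs : run gameStep 0 ω n = 13
    · have : ∀ b, gameStep 13 b = 13 := by decide
      simp [hs, this]
    · have hcons := prefix_cons_congr (ih₁ hs) (ω n)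
      refine ⟨fun hs' p hp => (hcons p hp).trans (gameLabel_gameStep _ hs _ hs' p hp), ?_⟩
      rw [history, hcons _ (by decide), hcons _ (by decide), ← gameStep_eq_iff _ hs]
      simp [hs]

/-- The expected remaining duration of the game in each state. -/
noncomputable def remainingDuration : Fin 14 → ℝ :=
  ![9110 / 71, 8968 / 71, 8684 / 71, 9002 / 71, 8224 / 71, 8752 / 71, 8082 / 71, 8252 / 71,
    6912 / 71, 7360 / 71, 4572 / 71, 6496 / 71, 4626 / 71, 0]

theorem stmt15
    (μ : Measure (ℕ → Bool)) [IsProbabilityMeasure μ]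
    (hμ : ∀ (n : ℕ) (b : ℕ → Bool),
      μ {ω | ∀ i < n, ω i = b i} = (1 / 2 : ℝ≥0∞) ^ n) :
    ∫⁻ ω, (duration [false, false, false, true, false, false, false]
            [false, false, true, false, false, false, false, true, false] ω : ℝ≥0∞) ∂μ
      = 9110 / 71 := by
  have hmeas : ∀ n, MeasurableSet {ω | run gameStep 0 ω n ≠ 13} := fun n =>
    measurable_run gameStep 0 n (.of_discrete (s := {t | t ≠ 13}))
  have hD : ∀ ω, (duration [false, false, false, true, false, false, false]
      [false, false, true, false, false, false, false, true, false] ω : ℝ≥0∞) =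
      ∑' n, {ω | run gameStep 0 ω n ≠ 13}.indicator 1 ω := fun ω =>
    duration_eq_tsum _ _ ω (fun n => run gameStep 0 ω n ≠ 13) fun n => (run_gameStep ω n).2
  simp_rw [hD]
  rw [lintegral_tsum fun n => (measurable_one.indicator (hmeas n)).aemeasurable]
  simp_rw [lintegral_indicator_one (hmeas _)]
  rw [tsum_measure_run_ne hμ gameStep 0 13 remainingDuration]
  · rw [remainingDuration, Matrix.cons_val_zero, ENNReal.ofReal_div_of_pos (by norm_num)]
    simp
  · intro t
    fin_cases t <;> simp [remainingDuration] <;> norm_num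
  · simp [remainingDuration]
  · decide
  · intro t ht
    fin_cases t <;> simp [remainingDuration, gameStep] at ht ⊢ <;> norm_num
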